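/- arXiv:2401.13002 — 5 statements merged into one kernel-verified Lean document; each statement's English description precedes it below -/
import Mathlib

section
/- Let n ≥ 1, let W be an integer, and let θ : {0,1,…,2n} → ℝ satisfy θ_{2n} = θ_0 + 2πW. For i ∈ {1,…,2n} define φ_i = (θ_{i-1} + θ_i)/2, and for indices i, j define δ_{i,j} = φ_j − φ_i. Suppose (a_1,b_1), …, (a_n,b_n) are pairs of indices with {a_1,…,a_n} ∪ {b_1,…,b_n} = {1,…,2n}, with b_i > a_i and b_i − a_i odd for each i. Then ∑_{i=1}^{n} (−1)^{b_i} · δ_{a_i, b_i} = Wπ. -/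
open Real Finset

/-- Two families of size `n` that jointly cover `{1, …, 2n}` enumerate it without repetition. -/
lemma sum_add_sum_eq_sum_Icc_of_cover {M : Type*} [AddCommMonoid M] {n : ℕ} {a b : Fin n → ℕ}
    (hcover : univ.image a ∪ univ.image b = Icc 1 (2 * n)) (f : ℕ → M) :
    ∑ i, f (a i) + ∑ i, f (b i) = ∑ k ∈ Icc 1 (2 * n), f k := by
  have himage : univ.image (Sum.elim a b) = Icc 1 (2 * n) := by
    rw [← hcover]
    ext k
    simp
  have hinj : Set.InjOn (Sum.elim a b) (univ : Finset (Fin n ⊕ Fin n)) := by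
    rw [← card_image_iff, himage]
    simp [two_mul]
  rw [← himage, sum_image hinj, Fintype.sum_sum_type]
  simp

/-- The alternating sum of consecutive midpoints telescopes. -/
lemma sum_Icc_neg_one_pow_mul_midpoint (θ : ℕ → ℝ) (m : ℕ) :
    ∑ k ∈ Icc 1 m, (-1 : ℝ) ^ k * ((θ (k - 1) + θ k) / 2) = ((-1) ^ m * θ m - θ 0) / 2 := by
  induction m with
  | zero => simp
  | succ m ih =>
    rw [sum_Icc_succ_top (by omega), ih, Nat.add_sub_cancel]
    ring

/-- **General cyclic 2n-gon angle theorem.**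
Let `n ≥ 1`, `W : ℤ`, and `θ : {0,…,2n} → ℝ` with `θ (2n) = θ 0 + 2πW`.
With `φ i = (θ (i-1) + θ i) / 2` and `δ i j = φ j - φ i`, if the pairs
`(a i, b i)` cover `{1,…,2n}`, with `b i > a i` and `b i - a i` odd,
then `∑ i, (-1)^(b i) • δ (a i) (b i) = W * π`. -/
theorem cyclic_polygon_angle_relation (n : ℕ) (hn : 1 ≤ n) (W : ℤ) (θ : ℕ → ℝ)
    (hθ : θ (2 * n) = θ 0 + 2 * Real.pi * W)
    (φ : ℕ → ℝ) (hφ : ∀ i, 1 ≤ i → i ≤ 2 * n → φ i = (θ (i - 1) + θ i) / 2)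
    (δ : ℕ → ℕ → ℝ) (hδ : ∀ i j, δ i j = φ j - φ i)
    (a b : Fin n → ℕ)
    (hcover : (Finset.image a Finset.univ) ∪ (Finset.image b Finset.univ)
      = Finset.Icc 1 (2 * n))
    (hlt : ∀ i, a i < b i)
    (hodd : ∀ i, Odd (b i - a i)) :
    ∑ i : Fin n, (-1 : ℝ) ^ (b i) * δ (a i) (b i) = W * Real.pi := by
  have hterm (i : Fin n) : (-1 : ℝ) ^ b i * δ (a i) (b i)
      = (-1) ^ a i * φ (a i) + (-1) ^ b i * φ (b i) := by
    obtain ⟨c, hc⟩ := hodd i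
    have hb : b i = a i + (2 * c + 1) := by have := hlt i; omega
    have hsign : (-1 : ℝ) ^ b i = -(-1) ^ a i := by
      rw [hb, pow_add, Odd.neg_one_pow ⟨c, rfl⟩, mul_neg_one]
    rw [hδ, hsign]
    ring
  calc ∑ i : Fin n, (-1 : ℝ) ^ b i * δ (a i) (b i)
      = ∑ k ∈ Icc 1 (2 * n), (-1 : ℝ) ^ k * φ k := by
        rw [sum_congr rfl fun i _ => hterm i, sum_add_distrib,
          sum_add_sum_eq_sum_Icc_of_cover hcover fun k => (-1 : ℝ) ^ k * φ k]
    _ = ∑ k ∈ Icc 1 (2 * n), (-1 : ℝ) ^ k * ((θ (k - 1) + θ k) / 2) :=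
        sum_congr rfl fun k hk => by rw [hφ k (mem_Icc.1 hk).1 (mem_Icc.1 hk).2]
    _ = W * Real.pi := by
        rw [sum_Icc_neg_one_pow_mul_midpoint, (even_two_mul n).neg_one_pow, hθ]
        ring
end

section
/- Let n ≥ 1 and let t_0, t_1, …, t_{2n} be real numbers with (cos t_{2n}, sin t_{2n}) = (cos t_0, sin t_0). Let p_j = (cos t_j, sin t_j) ∈ ℝ², and assume p_{j-1} ≠ p_j for all j ∈ {1,…,2n}; write s_j = p_j − p_{j-1} for the j-th side vector. Suppose (a_1,b_1), …, (a_n,b_n) are pairs of indices with {a_1,…,a_n} ∪ {b_1,…,b_n} = {1,…,2n}, b_i > a_i, and b_i − a_i odd for each i. If s_{a_i} and s_{b_i} are linearly dependent (parallel) for each i = 1, …, n−1, then s_{a_n} and s_{b_n} are linearly dependent. -/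
open Real Finset

namespace CyclicPolygon

open ComplexConjugate

lemma not_linearIndependent_pair_iff (u v : ℝ × ℝ) :
    ¬ LinearIndependent ℝ ![u, v] ↔ u.1 * v.2 = u.2 * v.1 := by
  rw [LinearIndependent.pair_iff]
  constructor
  · intro h
    by_contra hc
    have hd : u.1 * v.2 - u.2 * v.1 ≠ 0 := sub_ne_zero.mpr hc
    refine h fun x y hxy => ?_
    have h1 : x * u.1 + y * v.1 = 0 := by simpa using congrArg Prod.fst hxy
    have h2 : x * u.2 + y * v.2 = 0 := by simpa using congrArg Prod.snd hxy
    constructor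
    · refine (mul_eq_zero.mp ?_).resolve_right hd
      linear_combination v.2 * h1 - v.1 * h2
    · refine (mul_eq_zero.mp ?_).resolve_right hd
      linear_combination u.1 * h2 - u.2 * h1
  · intro hc h
    have h1 := h v.1 (-u.1) (by ext <;> simp <;> linarith)
    have h2 := h v.2 (-u.2) (by ext <;> simp <;> linarith)
    have hu : u = 0 := Prod.ext (neg_eq_zero.mp h1.2) (neg_eq_zero.mp h2.2)
    have hv : v = 0 := Prod.ext h1.1 h2.1
    exact one_ne_zero (h 1 1 (by simp [hu, hv])).1

lemma sub_eq_neg_mul_conj {y z : ℂ} (hy : y * conj y = 1) (hz : z * conj z = 1) :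
    z - y = -(y * z) * conj (z - y) := by
  rw [map_sub]
  linear_combination (-z) * hy + y * hz

/-- Two chords of the unit circle are parallel iff the products of their endpoints agree. -/
lemma cross_eq_iff_mul_eq_mul {y z y' z' : ℂ} (hy : y * conj y = 1) (hz : z * conj z = 1)
    (hy' : y' * conj y' = 1) (hz' : z' * conj z' = 1) (hne : y ≠ z) (hne' : y' ≠ z') :
    (z - y).re * (z' - y').im = (z - y).im * (z' - y').re ↔ y * z = y' * z' := by
  have hu := sub_eq_neg_mul_conj hy hz
  have hv := sub_eq_neg_mul_conj hy' hz'
  have hu0 : z - y ≠ 0 := sub_ne_zero.mpr hne.symm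
  have hv0 : z' - y' ≠ 0 := sub_ne_zero.mpr hne'.symm
  generalize z - y = u at *
  generalize z' - y' = v at *
  have hcu : conj u ≠ 0 := (map_ne_zero _).mpr hu0
  have hcv : conj v ≠ 0 := (map_ne_zero _).mpr hv0
  have key : u.re * v.im = u.im * v.re ↔ u * conj v = v * conj u := by
    simp only [Complex.ext_iff, Complex.mul_re, Complex.mul_im, Complex.conj_re, Complex.conj_im]
    constructor
    · intro h
      constructor <;> linarith
    · rintro ⟨-, h⟩
      linarith
  rw [key]
  constructor
  · intro h
    refine mul_right_cancel₀ (mul_ne_zero hcu hcv) ?_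
    linear_combination conj v * hu - conj u * hv - h
  · intro h
    linear_combination conj v * hu - conj u * hv - conj u * conj v * h

/-- The product of two consecutive terms at even positions, and its inverse at odd positions. -/
noncomputable def alternatingProd (z : ℕ → ℂ) (j : ℕ) : ℂ :=
  if Even j then z (j - 1) * z j else (z (j - 1) * z j)⁻¹

lemma prod_alternatingProd {z : ℕ → ℂ} (hz : ∀ j, z j ≠ 0) (n : ℕ) :
    ∏ j ∈ Icc 1 (2 * n), alternatingProd z j = z (2 * n) / z 0 := by
  induction n with
  | zero => simp [hz]
  | succ k ih =>
    rw [show 2 * (k + 1) = 2 * k + 1 + 1 by ring, prod_Icc_succ_top (by omega),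
      prod_Icc_succ_top (by omega), ih]
    have h1 : ¬ Even (2 * k + 1) := by simp
    have h2 : Even (2 * k + 1 + 1) := ⟨k + 1, by ring⟩
    simp only [alternatingProd, h1, h2, if_true, if_false, Nat.add_sub_cancel]
    have := hz 0
    have := hz (2 * k)
    have := hz (2 * k + 1)
    field_simp

lemma alternatingProd_mul_eq_one_iff {z : ℕ → ℂ} (hz : ∀ j, z j ≠ 0) {a b : ℕ} (hlt : a < b)
    (hodd : Odd (b - a)) :
    alternatingProd z a * alternatingProd z b = 1 ↔ z (a - 1) * z a = z (b - 1) * z b := by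
  have ha : z (a - 1) * z a ≠ 0 := mul_ne_zero (hz _) (hz _)
  have hb : z (b - 1) * z b ≠ 0 := mul_ne_zero (hz _) (hz _)
  have hab : Even b ↔ ¬ Even a := by grind
  by_cases h : Even a
  · rw [alternatingProd, alternatingProd, if_pos h, if_neg (by simpa [hab] using h),
      mul_inv_eq_one₀ hb]
  · rw [alternatingProd, alternatingProd, if_neg h, if_pos (hab.mpr h),
      inv_mul_eq_one₀ ha]

lemma prod_pairs {M : Type*} [CommMonoid M] {n : ℕ} {a b : Fin n → ℕ}
    (hcover : univ.image a ∪ univ.image b = Icc 1 (2 * n)) (f : ℕ → M) :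
    ∏ i, f (a i) * f (b i) = ∏ j ∈ Icc 1 (2 * n), f j := by
  have himage : univ.image (Sum.elim a b) = Icc 1 (2 * n) := by
    rw [← hcover]
    ext j
    simp
  have hinj : Set.InjOn (Sum.elim a b) (univ : Finset (Fin n ⊕ Fin n)) := by
    rw [← card_image_iff, himage]
    simp
    omega
  rw [← himage, prod_image hinj, Fintype.prod_sum_type, prod_mul_distrib]
  rfl

end CyclicPolygon

/-- **Parallel side pairs of a cyclic 2n-gon.** Let `p 0, …, p (2n)` be the
vertices of a closed polygon on the unit circle (`p (2n) = p 0`), with side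
vectors `s j = p j - p (j-1)`.  If the pairs `(a i, b i)` cover `{1,…,2n}`
with `b i > a i` and `b i - a i` odd, and the sides `s (a i)`, `s (b i)` are
parallel for `i = 1,…,n-1`, then `s (a n)` and `s (b n)` are parallel. -/
theorem cyclic_polygon_parallel_pairs (n : ℕ) (hn : 1 ≤ n) (t : ℕ → ℝ)
    (hclosed : (Real.cos (t (2 * n)), Real.sin (t (2 * n)))
      = (Real.cos (t 0), Real.sin (t 0)))
    (p : ℕ → ℝ × ℝ) (hp : ∀ j, p j = (Real.cos (t j), Real.sin (t j)))
    (hne : ∀ j, 1 ≤ j → j ≤ 2 * n → p (j - 1) ≠ p j)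
    (s : ℕ → ℝ × ℝ) (hs : ∀ j, s j = p j - p (j - 1))
    (a b : Fin n → ℕ)
    (hcover : (Finset.image a Finset.univ) ∪ (Finset.image b Finset.univ)
      = Finset.Icc 1 (2 * n))
    (hlt : ∀ i, a i < b i)
    (hodd : ∀ i, Odd (b i - a i))
    (hpar : ∀ i : Fin n, (i : ℕ) + 1 < n →
      ¬ LinearIndependent ℝ ![s (a i), s (b i)]) :
    ¬ LinearIndependent ℝ
        ![s (a ⟨n - 1, by omega⟩), s (b ⟨n - 1, by omega⟩)] := by
  have hz (j : ℕ) : Complex.mk (cos (t j)) (sin (t j)) *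
      starRingEnd ℂ (Complex.mk (cos (t j)) (sin (t j))) = 1 := by
    rw [Complex.mul_conj, Complex.normSq_mk, ← sq, ← sq, cos_sq_add_sin_sq, Complex.ofReal_one]
  set z : ℕ → ℂ := fun j => ⟨cos (t j), sin (t j)⟩
  have hz0 (j : ℕ) : z j ≠ 0 := left_ne_zero_of_mul_eq_one (hz j)
  have hzne (j : ℕ) (hj : j ∈ Icc 1 (2 * n)) : z (j - 1) ≠ z j := by
    intro h
    rw [mem_Icc] at hj
    apply hne j hj.1 hj.2
    rw [hp, hp]
    exact Prod.ext (Complex.ext_iff.mp h).1 (Complex.ext_iff.mp h).2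
  have ha (i : Fin n) : a i ∈ Icc 1 (2 * n) := by
    rw [← hcover]
    exact mem_union_left _ (mem_image_of_mem a (mem_univ i))
  have hb (i : Fin n) : b i ∈ Icc 1 (2 * n) := by
    rw [← hcover]
    exact mem_union_right _ (mem_image_of_mem b (mem_univ i))
  have hparallel (i : Fin n) : ¬ LinearIndependent ℝ ![s (a i), s (b i)] ↔
      CyclicPolygon.alternatingProd z (a i) * CyclicPolygon.alternatingProd z (b i) = 1 := by
    rw [CyclicPolygon.alternatingProd_mul_eq_one_iff hz0 (hlt i) (hodd i),
      CyclicPolygon.not_linearIndependent_pair_iff,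
      ← CyclicPolygon.cross_eq_iff_mul_eq_mul (hz _) (hz _) (hz _) (hz _)
        (hzne _ (ha i)) (hzne _ (hb i))]
    simp [hs, hp]
  have hend : z (2 * n) = z 0 :=
    Complex.ext (congrArg Prod.fst hclosed) (congrArg Prod.snd hclosed)
  have hprod := CyclicPolygon.prod_pairs hcover (CyclicPolygon.alternatingProd z)
  rw [CyclicPolygon.prod_alternatingProd hz0, hend, div_self (hz0 0),
    Fintype.prod_eq_single ⟨n - 1, by omega⟩] at hprod
  · exact (hparallel _).mpr hprod
  · intro i hi
    refine (hparallel i).mp (hpar i ?_)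
    have : (i : ℕ) ≠ n - 1 := fun h => hi (Fin.ext h)
    omega
end

section
/- Let A, B, C, D, E, F be points on a circle in the Euclidean plane (all six points equidistant from some center O, at a common positive radius), with A ≠ B, B ≠ C, C ≠ D, D ≠ E, E ≠ F, F ≠ A. If the side AB is parallel to the side DE (the vectors B − A and E − D are linearly dependent) and the side BC is parallel to the side EF, then the side CD is parallel to the side FA. -/
open Real

/-- Two vectors of the plane are linearly dependent iff their cross product vanishes. -/
lemma not_linearIndependent_pair_iff_cross_eq_zero (x y : EuclideanSpace ℝ (Fin 2)) :
    ¬ LinearIndependent ℝ ![x, y] ↔ x 0 * y 1 - x 1 * y 0 = 0 := by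
  have smul_add_smul_eq_zero (s t : ℝ) :
      s • x + t • y = 0 ↔ s * x 0 + t * y 0 = 0 ∧ s * x 1 + t * y 1 = 0 := by
    simp [PiLp.ext_iff, Fin.forall_fin_two]
  simp only [LinearIndependent.pair_iff, smul_add_smul_eq_zero]
  constructor
  · intro h
    by_contra hne
    refine h fun s t ⟨h0, h1⟩ => ⟨?_, ?_⟩
    · exact (mul_eq_zero.mp (by linear_combination y 1 * h0 - y 0 * h1)).resolve_right hne
    · exact (mul_eq_zero.mp (by linear_combination x 0 * h1 - x 1 * h0)).resolve_right hne
  · intro h hind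
    obtain ⟨hy0, hx0⟩ := hind (y 0) (-x 0) ⟨by ring, by linear_combination -h⟩
    obtain ⟨hy1, hx1⟩ := hind (y 1) (-x 1) ⟨by linear_combination h, by ring⟩
    exact one_ne_zero (hind 1 1 ⟨by linarith, by linarith⟩).1

open ComplexConjugate in
/-- Chords `ab` and `de` of a circle about the origin of `ℂ` have vanishing cross product iff
`ab = de`, unless one of them is degenerate. -/
lemma cross_chords_eq_zero_iff {a b d e : ℂ} {r : ℝ} (hr : 0 < r)
    (ha : ‖a‖ = r) (hb : ‖b‖ = r) (hd : ‖d‖ = r) (he : ‖e‖ = r) (hab : a ≠ b) (hde : d ≠ e) :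
    (b - a).re * (e - d).im - (b - a).im * (e - d).re = 0 ↔ a * b = d * e := by
  have conj_mul_self {z : ℂ} (hz : ‖z‖ = r) : conj z * z = (r : ℂ) ^ 2 := by
    rw [Complex.conj_mul', hz]
  have ne_zero {z : ℂ} (hz : ‖z‖ = r) : z ≠ 0 := norm_pos_iff.mp (hz ▸ hr)
  have hcross : (((b - a).re * (e - d).im - (b - a).im * (e - d).re : ℝ) : ℂ) * (2 * Complex.I) =
      conj (b - a) * (e - d) - (b - a) * conj (e - d) := by
    apply Complex.ext <;> simp <;> ring
  have key : (((b - a).re * (e - d).im - (b - a).im * (e - d).re : ℝ) : ℂ) *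
      (2 * Complex.I * (a * b * d * e)) =
      (r : ℂ) ^ 2 * (b - a) * (e - d) * (a * b - d * e) := by
    rw [← mul_assoc, hcross]
    simp only [map_sub]
    linear_combination (e - d) * d * e * (a * conj_mul_self hb - b * conj_mul_self ha) -
      (b - a) * a * b * (d * conj_mul_self he - e * conj_mul_self hd)
  have hr' : (r : ℂ) ≠ 0 := Complex.ofReal_ne_zero.mpr hr.ne'
  rw [← Complex.ofReal_eq_zero, ← sub_eq_zero (a := a * b)]
  constructor <;> intro h <;> rw [h] at key
  · simpa [hr', sub_ne_zero.mpr hab.symm, sub_ne_zero.mpr hde.symm] using key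
  · simpa only [mul_zero, mul_eq_zero, Complex.I_ne_zero, ne_zero ha, ne_zero hb, ne_zero hd,
      ne_zero he, OfNat.ofNat_ne_zero, or_false] using key

/-- Nondegenerate chords `AB` and `DE` of a circle with center `O` are parallel iff
`(A - O)(B - O) = (D - O)(E - O)` as complex numbers. -/
lemma chords_parallel_iff {O A B D E : EuclideanSpace ℝ (Fin 2)} {r : ℝ} (hr : 0 < r)
    (hA : dist A O = r) (hB : dist B O = r) (hD : dist D O = r) (hE : dist E O = r)
    (hAB : A ≠ B) (hDE : D ≠ E) :
    ¬ LinearIndependent ℝ ![B - A, E - D] ↔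
      Complex.orthonormalBasisOneI.repr.symm (A - O) *
          Complex.orthonormalBasisOneI.repr.symm (B - O) =
        Complex.orthonormalBasisOneI.repr.symm (D - O) *
          Complex.orthonormalBasisOneI.repr.symm (E - O) := by
  have norm_eq {P : EuclideanSpace ℝ (Fin 2)} (hP : dist P O = r) :
      ‖Complex.orthonormalBasisOneI.repr.symm (P - O)‖ = r := by
    rw [LinearIsometryEquiv.norm_map, ← dist_eq_norm, hP]
  rw [not_linearIndependent_pair_iff_cross_eq_zero,
    ← cross_chords_eq_zero_iff hr (norm_eq hA) (norm_eq hB) (norm_eq hD) (norm_eq hE)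
      (by simpa only [ne_eq, EmbeddingLike.apply_eq_iff_eq, sub_left_inj] using hAB)
      (by simpa only [ne_eq, EmbeddingLike.apply_eq_iff_eq, sub_left_inj] using hDE)]
  simp only [← map_sub, sub_sub_sub_cancel_right]
  simp

/-- **Cyclic hexagon with two pairs of opposite sides parallel.** If
`A, B, C, D, E, F` lie on a circle with center `O` and radius `r > 0`, with
consecutive vertices distinct, and `AB ∥ DE` and `BC ∥ EF`, then `CD ∥ FA`. -/
theorem cyclic_hexagon_parallel (O A B C D E F : EuclideanSpace ℝ (Fin 2))
    (r : ℝ) (hr : 0 < r)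
    (hA : dist A O = r) (hB : dist B O = r) (hC : dist C O = r)
    (hD : dist D O = r) (hE : dist E O = r) (hF : dist F O = r)
    (hAB : A ≠ B) (hBC : B ≠ C) (hCD : C ≠ D)
    (hDE : D ≠ E) (hEF : E ≠ F) (hFA : F ≠ A)
    (h₁ : ¬ LinearIndependent ℝ ![B - A, E - D])
    (h₂ : ¬ LinearIndependent ℝ ![C - B, F - E]) :
    ¬ LinearIndependent ℝ ![D - C, A - F] := by
  rw [chords_parallel_iff hr hA hB hD hE hAB hDE] at h₁
  rw [chords_parallel_iff hr hB hC hE hF hBC hEF] at h₂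
  rw [chords_parallel_iff hr hC hD hF hA hCD hFA]
  have ne_zero {P : EuclideanSpace ℝ (Fin 2)} (hP : dist P O = r) :
      Complex.orthonormalBasisOneI.repr.symm (P - O) ≠ 0 := by
    rw [← norm_pos_iff, LinearIsometryEquiv.norm_map, ← dist_eq_norm, hP]
    exact hr
  refine mul_left_cancel₀ (mul_ne_zero (ne_zero hB) (ne_zero hE)) ?_
  linear_combination Complex.orthonormalBasisOneI.repr.symm (D - O) *
    Complex.orthonormalBasisOneI.repr.symm (E - O) * h₂ -
    Complex.orthonormalBasisOneI.repr.symm (E - O) *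
    Complex.orthonormalBasisOneI.repr.symm (F - O) * h₁
end

section
/- Let n ≥ 2 and let A_1, A_2, …, A_{2n} be the vertices of a convex cyclic 2n-gon: there exist a center O ∈ ℝ², a radius r > 0, and real numbers t_1 < t_2 < … < t_{2n} < t_1 + 2π with A_j = O + r·(cos t_j, sin t_j) for each j. Then the sum of the (non-reflex, undirected) interior angles at the even-indexed vertices satisfies ∑_{i=1}^{n} ∠A_{2i−1} A_{2i} A_{2i+1} = (n−1)π, where indices are taken mod 2n (so A_{2n+1} = A_1). -/
open Real EuclideanGeometry Finset

/-- The point at parameter `θ` on the circle of center `O` and radius `r`. -/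
noncomputable def circlePoint (O : EuclideanSpace ℝ (Fin 2)) (r θ : ℝ) :
    EuclideanSpace ℝ (Fin 2) :=
  O + r • (WithLp.equiv 2 (Fin 2 → ℝ)).symm ![Real.cos θ, Real.sin θ]

theorem circlePoint_add_two_pi (O : EuclideanSpace ℝ (Fin 2)) (r θ : ℝ) :
    circlePoint O r (θ + 2 * π) = circlePoint O r θ := by
  simp [circlePoint]

/-- A chord of a circle, as a multiple of the unit vector normal to its bisecting radius. -/
theorem circlePoint_vsub_circlePoint (O : EuclideanSpace ℝ (Fin 2)) (r a b : ℝ) :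
    circlePoint O r a -ᵥ circlePoint O r b =
      (2 * r * sin ((b - a) / 2)) • !₂[sin ((a + b) / 2), -cos ((a + b) / 2)] := by
  ext i
  fin_cases i
  · have h := cos_sub_cos a b
    rw [← neg_sub b a, neg_div, sin_neg] at h
    simp [circlePoint]
    linear_combination r * h
  · have h := sin_sub_sin a b
    rw [← neg_sub b a, neg_div, sin_neg] at h
    simp [circlePoint]
    linear_combination r * h

/-- The inscribed angle at `b` is `π` minus half the arc from `a` to `c` through `b`. -/
theorem angle_circlePoint (O : EuclideanSpace ℝ (Fin 2)) {r a b c : ℝ} (hr : 0 < r)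
    (hab : a < b) (hbc : b < c) (hca : c ≤ a + 2 * π) :
    ∠ (circlePoint O r a) (circlePoint O r b) (circlePoint O r c) = π - (c - a) / 2 := by
  have hs₁ : 0 < 2 * r * sin ((b - a) / 2) :=
    mul_pos (by positivity) (sin_pos_of_pos_of_lt_pi (by linarith) (by linarith))
  have hs₂ : 0 < 2 * r * sin ((c - b) / 2) :=
    mul_pos (by positivity) (sin_pos_of_pos_of_lt_pi (by linarith) (by linarith))
  have hc : circlePoint O r c -ᵥ circlePoint O r b =
      (2 * r * sin ((c - b) / 2)) • -!₂[sin ((b + c) / 2), -cos ((b + c) / 2)] := by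
    rw [← neg_vsub_eq_vsub_rev, circlePoint_vsub_circlePoint, smul_neg]
  have hnorm (m : ℝ) : ‖!₂[sin m, -cos m]‖ = 1 := by
    simp [EuclideanSpace.norm_eq]
  have hinner : inner ℝ !₂[sin ((a + b) / 2), -cos ((a + b) / 2)]
      !₂[sin ((b + c) / 2), -cos ((b + c) / 2)] = cos ((c - a) / 2) := by
    rw [show (c - a) / 2 = (b + c) / 2 - (a + b) / 2 by ring, cos_sub]
    simp [PiLp.inner_apply]
    ring
  rw [EuclideanGeometry.angle, circlePoint_vsub_circlePoint, hc,
    InnerProductGeometry.angle_smul_left_of_pos _ _ hs₁,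
    InnerProductGeometry.angle_smul_right_of_pos _ _ hs₂,
    InnerProductGeometry.angle_neg_right, InnerProductGeometry.angle, hinner, hnorm, hnorm,
    mul_one, div_one, arccos_cos (by linarith) (by linarith)]

/-- **Alternating angle sum of a convex cyclic 2n-gon.** If `A 1, …, A (2n)`
lie in cyclic order on a circle of center `O` and radius `r > 0` (with
`A (2n+1) = A 1`), then the interior angles at the even-indexed vertices sum
to `(n-1)π`. -/
theorem convex_cyclic_polygon_even_angle_sum (n : ℕ) (hn : 2 ≤ n)
    (O : EuclideanSpace ℝ (Fin 2)) (r : ℝ) (hr : 0 < r) (t : ℕ → ℝ)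
    (hmono : ∀ j, 1 ≤ j → j < 2 * n → t j < t (j + 1))
    (ht : t (2 * n) < t 1 + 2 * Real.pi)
    (A : ℕ → EuclideanSpace ℝ (Fin 2))
    (hA : ∀ j, 1 ≤ j → j ≤ 2 * n →
      A j = O + r • (WithLp.equiv 2 (Fin 2 → ℝ)).symm ![Real.cos (t j), Real.sin (t j)])
    (hwrap : A (2 * n + 1) = A 1) :
    ∑ i ∈ Finset.range n, ∠ (A (2 * i + 1)) (A (2 * i + 2)) (A (2 * i + 3))
      = ((n : ℝ) - 1) * Real.pi := by
  set u : ℕ → ℝ := fun j => if j ≤ 2 * n then t j else t 1 + 2 * π with hu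
  have hu₁ : u 1 = t 1 := if_pos (by omega)
  have hulast : u (2 * n + 1) = u 1 + 2 * π := by
    rw [hu₁]
    exact if_neg (by omega)
  have hAu : ∀ j, 1 ≤ j → j ≤ 2 * n + 1 → A j = circlePoint O r (u j) := by
    intro j hj hjn
    by_cases h : j ≤ 2 * n
    · simpa only [hu, if_pos h, circlePoint] using hA j hj h
    · obtain rfl : j = 2 * n + 1 := by omega
      rw [hwrap, hulast, hu₁, circlePoint_add_two_pi]
      exact hA 1 le_rfl (by omega)
  have hstep : ∀ j, 1 ≤ j → j ≤ 2 * n → u j < u (j + 1) := by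
    intro j hj hjn
    rcases hjn.lt_or_eq with h | rfl
    · simpa [hu, hjn, Nat.succ_le_of_lt h] using hmono j hj h
    · simpa [hu] using ht
  have hmonoOn : MonotoneOn u (Set.Icc 1 (2 * n + 1)) :=
    monotoneOn_of_le_add_one Set.ordConnected_Icc fun j _ hj hj' =>
      (hstep j hj.1 (Nat.le_of_succ_le_succ hj'.2)).le
  have hangle : ∀ i ∈ range n, ∠ (A (2 * i + 1)) (A (2 * i + 2)) (A (2 * i + 3)) =
      π - (u (2 * (i + 1) + 1) - u (2 * i + 1)) / 2 := by
    intro i hi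
    have hin := mem_range.mp hi
    have hfirst : u 1 ≤ u (2 * i + 1) :=
      hmonoOn ⟨le_rfl, by omega⟩ ⟨by omega, by omega⟩ (by omega)
    have hlast : u (2 * i + 3) ≤ u (2 * n + 1) :=
      hmonoOn ⟨by omega, by omega⟩ ⟨by omega, le_rfl⟩ (by omega)
    rw [hAu _ (by omega) (by omega), hAu _ (by omega) (by omega), hAu _ (by omega) (by omega)]
    exact angle_circlePoint O hr (hstep _ (by omega) (by omega))
      (hstep _ (by omega) (by omega)) (by linarith)
  rw [sum_congr rfl hangle, sum_sub_distrib, ← sum_div,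
    sum_range_sub (fun i => u (2 * i + 1)) n, hulast]
  simp
  ring
end

section
/- Let A, B, C, D, E be the vertices of a convex cyclic pentagon: there exist a center O ∈ ℝ², a radius r > 0, and real numbers t_1 < t_2 < … < t_5 < t_1 + 2π with A, B, C, D, E equal to O + r·(cos t_j, sin t_j) for j = 1, …, 5 respectively. Then ∠ABC + ∠CDE − ∠ECA = π. -/
open Real EuclideanGeometry

/-- The chord between two points of the unit circle, as a multiple of a unit vector. -/
lemma circlePoint_sub_circlePoint (x y : ℝ) :
    (!₂[cos x, sin x] - !₂[cos y, sin y] : EuclideanSpace ℝ (Fin 2)) =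
      (2 * sin ((x - y) / 2)) • !₂[-sin ((x + y) / 2), cos ((x + y) / 2)] := by
  ext i
  fin_cases i
  · simp [cos_sub_cos]
    ring
  · simp [sin_sub_sin]

/-- The backward tangent direction of the unit circle at parameter `u` and the forward one at `v`
make an angle `π - (v - u)` when `0 ≤ v - u ≤ π`. -/
lemma angle_neg_tangent_tangent {u v : ℝ} (h₀ : 0 ≤ v - u) (h₁ : v - u ≤ π) :
    InnerProductGeometry.angle (-!₂[-sin u, cos u] : EuclideanSpace ℝ (Fin 2))
      !₂[-sin v, cos v] = π - (v - u) := by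
  have hnorm (w : ℝ) : ‖(!₂[-sin w, cos w] : EuclideanSpace ℝ (Fin 2))‖ = 1 := by
    simp [EuclideanSpace.norm_eq]
  have hinner : inner ℝ (!₂[-sin u, cos u] : EuclideanSpace ℝ (Fin 2)) !₂[-sin v, cos v] =
      cos (v - u) := by
    simp [PiLp.inner_apply, Fin.sum_univ_two, cos_sub]
    ring
  rw [InnerProductGeometry.angle_neg_left, InnerProductGeometry.angle, hnorm, hnorm, hinner,
    mul_one, div_one, arccos_cos h₀ h₁]

/-- **Inscribed angle theorem** for points of a circle given by increasing parameters. -/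
lemma angle_circle_eq (O : EuclideanSpace ℝ (Fin 2)) {r : ℝ} (hr : 0 < r) {a b c : ℝ}
    (hab : a < b) (hbc : b < c) (hca : c < a + 2 * π) :
    ∠ (O + r • !₂[cos a, sin a]) (O + r • !₂[cos b, sin b]) (O + r • !₂[cos c, sin c]) =
      π - (c - a) / 2 := by
  have hleft : (!₂[cos a, sin a] - !₂[cos b, sin b] : EuclideanSpace ℝ (Fin 2)) =
      (2 * sin ((b - a) / 2)) • -!₂[-sin ((a + b) / 2), cos ((a + b) / 2)] := by
    rw [circlePoint_sub_circlePoint, smul_neg, ← neg_smul, ← mul_neg, ← sin_neg ((b - a) / 2),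
      ← neg_div, neg_sub]
  have hpos₁ : 0 < 2 * sin ((b - a) / 2) :=
    mul_pos two_pos (sin_pos_of_pos_of_lt_pi (by linarith) (by linarith))
  have hpos₂ : 0 < 2 * sin ((c - b) / 2) :=
    mul_pos two_pos (sin_pos_of_pos_of_lt_pi (by linarith) (by linarith))
  rw [EuclideanGeometry.angle, vsub_eq_sub, vsub_eq_sub, add_sub_add_left_eq_sub,
    add_sub_add_left_eq_sub, ← smul_sub, ← smul_sub, hleft, circlePoint_sub_circlePoint c b,
    InnerProductGeometry.angle_smul_left_of_pos _ _ hr,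
    InnerProductGeometry.angle_smul_right_of_pos _ _ hr,
    InnerProductGeometry.angle_smul_left_of_pos _ _ hpos₁,
    InnerProductGeometry.angle_smul_right_of_pos _ _ hpos₂,
    angle_neg_tangent_tangent (by linarith) (by linarith)]
  ring

/-- **Convex cyclic pentagon.** If `A, B, C, D, E` lie in cyclic order on a
circle, then `∠ABC + ∠CDE - ∠ECA = π`. -/
theorem convex_cyclic_pentagon_angles
    (O : EuclideanSpace ℝ (Fin 2)) (r : ℝ) (hr : 0 < r)
    (t₁ t₂ t₃ t₄ t₅ : ℝ)
    (h₁₂ : t₁ < t₂) (h₂₃ : t₂ < t₃) (h₃₄ : t₃ < t₄) (h₄₅ : t₄ < t₅)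
    (h₅₁ : t₅ < t₁ + 2 * Real.pi)
    (A B C D E : EuclideanSpace ℝ (Fin 2))
    (hA : A = O + r • (WithLp.equiv 2 (Fin 2 → ℝ)).symm ![Real.cos t₁, Real.sin t₁])
    (hB : B = O + r • (WithLp.equiv 2 (Fin 2 → ℝ)).symm ![Real.cos t₂, Real.sin t₂])
    (hC : C = O + r • (WithLp.equiv 2 (Fin 2 → ℝ)).symm ![Real.cos t₃, Real.sin t₃])
    (hD : D = O + r • (WithLp.equiv 2 (Fin 2 → ℝ)).symm ![Real.cos t₄, Real.sin t₄])
    (hE : E = O + r • (WithLp.equiv 2 (Fin 2 → ℝ)).symm ![Real.cos t₅, Real.sin t₅]) :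
    ∠ A B C + ∠ C D E - ∠ E C A = Real.pi := by
  rw [EuclideanGeometry.angle_comm E C A]
  subst hA hB hC hD hE
  have hABC := angle_circle_eq O hr h₁₂ h₂₃ (by linarith)
  have hCDE := angle_circle_eq O hr h₃₄ h₄₅ (by linarith)
  have hACE := angle_circle_eq O hr (h₁₂.trans h₂₃) (h₃₄.trans h₄₅) h₅₁
  simp only [WithLp.equiv_symm_apply]
  rw [hABC, hCDE, hACE]
  ring
end
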